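/- arXiv:2010.08594 — 2 statements merged into one kernel-verified Lean document; each statement's English description precedes it below -/
import Mathlib

section
/- For every integer n ≥ 2, the map sending a tuple (k₁, ..., kₙ) ∈ ℤⁿ with k₁ + ... + kₙ = 0 to the diagonal matrix diag(u₀^{k₁}, ..., u₀^{kₙ}) is a well-defined injective group homomorphism from the group {k ∈ ℤⁿ : Σᵢ kᵢ = 0} (which is isomorphic to ℤ^{n-1}) into Γ_n; in particular each such diagonal matrix lies in SL_n(O_L) and satisfies τ(gᵀ)·D_n·g = D_n. -/
open IntermediateField Polynomial Matrix

/-- The real fourth root of `2`. -/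
noncomputable def alpha : ℝ := (2 : ℝ) ^ ((1 : ℝ) / 4)

/-- The number field `L = ℚ(2^{1/4})`, as a subfield of `ℝ`. -/
noncomputable def L : IntermediateField ℚ ℝ := ℚ⟮alpha⟯

noncomputable def alphaL : L := ⟨alpha, IntermediateField.mem_adjoin_simple_self ℚ alpha⟩

/-- The unit `u₀ = (3 + 2√2) + (2 + 2√2)·α` of `O_L`. -/
noncomputable def u0 : L := (3 + 2 * alphaL ^ 2) + (2 + 2 * alphaL ^ 2) * alphaL

/-- The matrix `D_n = diag(-1, √2, ..., √2)` over `L`, where `√2 = α²`. -/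
noncomputable def Dmat (n : ℕ) : Matrix (Fin n) (Fin n) L :=
  Matrix.diagonal fun i => if (i : ℕ) = 0 then -1 else alphaL ^ 2

theorem alphaL_pow_four : alphaL ^ 4 = 2 := by
  apply Subtype.ext
  change alpha ^ 4 = 2
  unfold alpha
  rw [← Real.rpow_natCast, ← Real.rpow_mul (by norm_num)]
  norm_num

/-- The image of `u0` under `τ`. -/
noncomputable def v0 : L := (3 + 2 * alphaL ^ 2) - (2 + 2 * alphaL ^ 2) * alphaL

theorem v0_mul_u0 : v0 * u0 = 1 := by
  unfold v0 u0
  linear_combination (-4 * alphaL ^ 2 - 4) * alphaL_pow_four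

theorem u0_ne_zero : u0 ≠ 0 := right_ne_zero_of_mul_eq_one v0_mul_u0

theorem isIntegral_alphaL : IsIntegral ℤ alphaL := by
  apply IsIntegral.of_pow (n := 4) (by norm_num)
  rw [alphaL_pow_four]
  exact isIntegral_algebraMap (R := ℤ) (x := 2)

theorem isIntegral_three : IsIntegral ℤ (3 : L) := isIntegral_algebraMap (R := ℤ) (x := 3)

theorem isIntegral_two : IsIntegral ℤ (2 : L) := isIntegral_algebraMap (R := ℤ) (x := 2)

theorem isIntegral_u0 : IsIntegral ℤ u0 :=
  (isIntegral_three.add (isIntegral_two.mul (isIntegral_alphaL.pow 2))).add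
    ((isIntegral_two.add (isIntegral_two.mul (isIntegral_alphaL.pow 2))).mul isIntegral_alphaL)

theorem isIntegral_v0 : IsIntegral ℤ v0 :=
  (isIntegral_three.add (isIntegral_two.mul (isIntegral_alphaL.pow 2))).sub
    ((isIntegral_two.add (isIntegral_two.mul (isIntegral_alphaL.pow 2))).mul isIntegral_alphaL)

theorem u0_inv : u0⁻¹ = v0 := (eq_inv_of_mul_eq_one_left v0_mul_u0).symm

theorem isIntegral_u0_zpow (k : ℤ) : IsIntegral ℤ (u0 ^ k) := by
  obtain ⟨m, rfl | rfl⟩ := k.eq_nat_or_neg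
  · rw [zpow_natCast]
    exact isIntegral_u0.pow m
  · rw [_root_.zpow_neg, zpow_natCast, ← inv_pow, u0_inv]
    exact isIntegral_v0.pow m

theorem u0_zpow_injective : Function.Injective fun k : ℤ => u0 ^ k := by
  have h1 : (1 : ℝ) < (u0 : ℝ) := by
    change (1 : ℝ) < (3 + 2 * alpha ^ 2) + (2 + 2 * alpha ^ 2) * alpha
    have : 0 < alpha := by unfold alpha; positivity
    have : 0 < (2 + 2 * alpha ^ 2) * alpha := by positivity
    nlinarith [sq_nonneg alpha]
  intro a b hab
  have hab' : (u0 : ℝ) ^ a = (u0 : ℝ) ^ b := by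
    have := congrArg (algebraMap L ℝ) hab
    simp only [map_zpow₀] at this
    exact this
  exact (zpow_right_strictMono₀ h1).injective hab'

theorem prod_zpow_sum {n : ℕ} (k : Fin n → ℤ) : ∏ i, u0 ^ k i = u0 ^ (∑ i, k i) := by
  have h : ∀ s : Finset (Fin n), ∏ i ∈ s, u0 ^ k i = u0 ^ (∑ i ∈ s, k i) := by
    intro s
    induction s using Finset.induction_on with
    | empty => simp
    | insert a s ha ih => rw [Finset.prod_insert ha, Finset.sum_insert ha, ih, zpow_add₀ u0_ne_zero]
  exact h _

/-- The map `(k₁, ..., kₙ) ↦ diag(u₀^{k₁}, ..., u₀^{kₙ})`, on tuples with `k₁ + ... + kₙ = 0`,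
is a well-defined injective group homomorphism into `Γ_n`: each such diagonal matrix has
algebraic-integer entries, determinant one, and satisfies `τ(gᵀ)·D_n·g = D_n`; moreover the map
is multiplicative and injective. -/
theorem stmt8 (n : ℕ) (hn : 2 ≤ n) (τ : L ≃ₐ[ℚ] L) (hτ : τ alphaL = -alphaL) :
    (∀ k : Fin n → ℤ, (∑ i, k i) = 0 →
        (∀ i j, IsIntegral ℤ (Matrix.diagonal (fun i => u0 ^ k i) i j)) ∧
        (Matrix.diagonal (fun i => u0 ^ k i)).det = 1 ∧
        ((Matrix.diagonal (fun i => u0 ^ k i)).transpose.map τ) * Dmat n *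
            Matrix.diagonal (fun i => u0 ^ k i) = Dmat n) ∧
    (∀ k k' : Fin n → ℤ, (∑ i, k i) = 0 → (∑ i, k' i) = 0 →
        Matrix.diagonal (fun i => u0 ^ (k i + k' i)) =
          Matrix.diagonal (fun i => u0 ^ k i) * Matrix.diagonal (fun i => u0 ^ k' i)) ∧
    (∀ k k' : Fin n → ℤ, (∑ i, k i) = 0 → (∑ i, k' i) = 0 →
        Matrix.diagonal (fun i => u0 ^ k i) = Matrix.diagonal (fun i => u0 ^ k' i) → k = k') := by
  refine ⟨fun k hk => ⟨fun i j => ?_, ?_, ?_⟩, fun k k' _ _ => ?_, fun k k' _ _ h => ?_⟩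
  · by_cases hij : i = j
    · subst hij
      rw [Matrix.diagonal_apply_eq]
      exact isIntegral_u0_zpow _
    · rw [Matrix.diagonal_apply_ne _ hij]
      exact isIntegral_zero
  · rw [Matrix.det_diagonal, prod_zpow_sum, hk, zpow_zero]
  · have hτu : τ u0 = v0 := by
      unfold u0 v0
      simp only [map_add, map_mul, map_pow, hτ, map_ofNat]
      ring
    rw [Matrix.diagonal_transpose, Matrix.diagonal_map (map_zero τ), Dmat,
      Matrix.diagonal_mul_diagonal, Matrix.diagonal_mul_diagonal]
    congr 1
    funext i
    have h : τ (u0 ^ k i) * u0 ^ k i = 1 := by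
      rw [map_zpow₀, hτu, ← mul_zpow, v0_mul_u0, _root_.one_zpow]
    rw [mul_right_comm]
    simp only [h, one_mul]
  · rw [Matrix.diagonal_mul_diagonal]
    congr 1
    funext i
    exact zpow_add₀ u0_ne_zero _ _
  · funext i
    exact u0_zpow_injective (congrFun (Matrix.diagonal_injective h) i)
end

section
/- For every integer n ≥ 2, the subgroup G_ℚ = {g ∈ SL_n(L) : τ(gᵀ)·D_n·g = D_n}, viewed inside SL_n(ℝ) via the inclusion L ⊂ ℝ, is dense in SL_n(ℝ). -/
open IntermediateField Polynomial Matrix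

/-- The natural topology on `SL_n(ℝ)`, induced from the space of matrices. -/
instance (n : ℕ) : TopologicalSpace (Matrix.SpecialLinearGroup (Fin n) ℝ) :=
  TopologicalSpace.induced
    (fun g => (g : Matrix (Fin n) (Fin n) ℝ)) inferInstance

lemma alpha_pos : 0 < alpha := by unfold alpha; positivity

lemma alphaL_ne : alphaL ≠ 0 := by
  intro h
  have : (alphaL : ℝ) = 0 := by rw [h]; rfl
  exact alpha_pos.ne' this

/-- The diagonal entries of `Dmat`. -/
noncomputable def dvec (n : ℕ) : Fin n → L := fun i => if (i : ℕ) = 0 then -1 else alphaL ^ 2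

lemma dvec_ne (n : ℕ) (i : Fin n) : dvec n i ≠ 0 := by
  unfold dvec
  split_ifs
  · simp
  · exact pow_ne_zero _ alphaL_ne

/-- The unitary group over `L`. -/
def Uset (n : ℕ) (τ : L ≃ₐ[ℚ] L) : Set (Matrix (Fin n) (Fin n) L) :=
  {h | (h.transpose.map τ) * Dmat n * h = Dmat n}

/-- The entrywise inclusion. -/
noncomputable def incl (n : ℕ) : Matrix (Fin n) (Fin n) L →+* Matrix (Fin n) (Fin n) ℝ :=
  (algebraMap L ℝ).mapMatrix

lemma incl_det (n : ℕ) (A : Matrix (Fin n) (Fin n) L) :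
    (incl n A).det = algebraMap L ℝ A.det := by
  unfold incl; rw [RingHom.map_det]

/-- The skew-hermitian matrices over `L`. -/
def Skew (n : ℕ) (τ : L ≃ₐ[ℚ] L) : Set (Matrix (Fin n) (Fin n) L) :=
  {A | (A.transpose.map τ) * Dmat n = - (Dmat n * A)}

lemma denseRange_rat (n : ℕ) :
    DenseRange (fun P : Matrix (Fin n) (Fin n) ℚ => P.map ((↑) : ℚ → ℝ)) := by
  have h1 : DenseRange ((↑) : ℚ → ℝ) := Rat.denseRange_cast
  exact DenseRange.piMap (fun _ => DenseRange.piMap fun _ => h1)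

lemma skew_dense (n : ℕ) (τ : L ≃ₐ[ℚ] L) (hτ : τ alphaL = -alphaL) :
    Dense (incl n '' Skew n τ) := by
  let Φ : Matrix (Fin n) (Fin n) ℝ × Matrix (Fin n) (Fin n) ℝ → Matrix (Fin n) (Fin n) ℝ :=
    fun x => Matrix.of fun i j => (dvec n i : ℝ)⁻¹ *
      (alpha * (x.1 i j + x.1 j i) + (x.2 i j - x.2 j i))
  have hΦ : Continuous Φ := by
    refine continuous_pi fun i => continuous_pi fun j => ?_
    have a1 : Continuous fun x : Matrix (Fin n) (Fin n) ℝ × Matrix (Fin n) (Fin n) ℝ => x.1 :=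
      continuous_fst
    have a2 : Continuous fun x : Matrix (Fin n) (Fin n) ℝ × Matrix (Fin n) (Fin n) ℝ => x.2 :=
      continuous_snd
    have b1 := fun i j => a1.matrix_elem i j
    have b2 := fun i j => a2.matrix_elem i j
    exact continuous_const.mul ((continuous_const.mul ((b1 i j).add (b1 j i))).add
      ((b2 i j).sub (b2 j i)))
  have hs : Function.Surjective Φ := by
    intro R
    refine ⟨(Matrix.of fun i j => (dvec n i : ℝ) * R i j / (2 * alpha),
      Matrix.of fun i j => (dvec n i : ℝ) * R i j / 2), ?_⟩
    ext i j
    have hd : (dvec n i : ℝ) ≠ 0 := by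
      simpa using dvec_ne n i
    have ha := alpha_pos.ne'
    simp only [Φ, Matrix.of_apply]
    field_simp
    ring
  have hd := hs.denseRange.comp ((denseRange_rat n).prodMap (denseRange_rat n)) hΦ
  refine Dense.mono ?_ hd
  rintro _ ⟨⟨P, Q⟩, rfl⟩
  refine ⟨Matrix.of fun i j => (dvec n i)⁻¹ *
      (alphaL * ((P i j : L) + (P j i : L)) + ((Q i j : L) - (Q j i : L))), ?_, ?_⟩
  · have hτd : ∀ i, τ (dvec n i) = dvec n i := by
      intro i; unfold dvec; split_ifs <;> simp [hτ]
    change _ * Matrix.diagonal (dvec n) = -(Matrix.diagonal (dvec n) * _)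
    ext1 i j
    have hi := dvec_ne n i
    have hj := dvec_ne n j
    simp only [Matrix.mul_diagonal, Matrix.neg_apply, Matrix.diagonal_mul, Matrix.map_apply,
      Matrix.transpose_apply, Matrix.of_apply, map_mul, map_add, map_sub, map_inv₀, hτ, hτd,
      map_ratCast]
    field_simp
    ring
  · ext i j
    simp only [incl, Φ, RingHom.mapMatrix_apply, Matrix.map_apply, Matrix.of_apply, map_mul,
      map_add, map_sub, map_inv₀, map_ratCast, Function.comp, Prod.map]
    rfl

lemma cayley_mem (n : ℕ) (τ : L ≃ₐ[ℚ] L) (A : Matrix (Fin n) (Fin n) L) (hA : A ∈ Skew n τ)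
    (hd : (1 + A).det ≠ 0) : (1 - A) * (1 + A)⁻¹ ∈ Uset n τ := by
  have hA' : (A.transpose.map τ) * Dmat n = - (Dmat n * A) := hA
  have hu : IsUnit (1 + A).det := hd.isUnit
  set h := (1 - A) * (1 + A)⁻¹ with hh
  have h1 : h * (1 + A) = 1 - A := by
    rw [hh, Matrix.mul_assoc, Matrix.nonsing_inv_mul _ hu, Matrix.mul_one]
  set A' := A.transpose.map τ with hA'def
  set h' := h.transpose.map τ with hh'
  have hmap : ∀ M N : Matrix (Fin n) (Fin n) L, (M * N).transpose.map τ
      = N.transpose.map τ * M.transpose.map τ := by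
    intro M N
    rw [Matrix.transpose_mul, Matrix.map_mul]
  have e1 : (1 + A).transpose.map τ = 1 + A' := by
    ext1 i j; simp [hA'def, Matrix.one_apply, apply_ite τ]
  have e2 : (1 - A).transpose.map τ = 1 - A' := by
    ext1 i j; simp [hA'def, Matrix.one_apply, apply_ite τ]
  have h2 : (1 + A') * h' = 1 - A' := by
    rw [← e1, ← e2, ← h1, hmap]
  have hu' : IsUnit (1 + A') := by
    rw [Matrix.isUnit_iff_isUnit_det, ← e1]
    have : ((1 + A).transpose.map τ).det = τ ((1 + A).transpose.det) := by
      have := (AlgEquiv.map_det τ (1 + A).transpose)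
      exact this.symm
    rw [this, Matrix.det_transpose]
    exact hu.map τ
  have huA : IsUnit (1 + A) := (Matrix.isUnit_iff_isUnit_det _).2 hu
  change h' * Dmat n * h = Dmat n
  apply hu'.mul_left_cancel
  apply huA.mul_right_cancel
  calc (1 + A') * (h' * Dmat n * h) * (1 + A)
      = ((1 + A') * h') * Dmat n * (h * (1 + A)) := by noncomm_ring
    _ = (1 - A') * Dmat n * (1 - A) := by rw [h1, h2]
    _ = (Dmat n - A' * Dmat n) * (1 - A) := by noncomm_ring
    _ = (Dmat n + A' * Dmat n) * (1 + A) := by rw [hA']; noncomm_ring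
    _ = _ := by noncomm_ring

lemma inv_contAt (n : ℕ) (M : Matrix (Fin n) (Fin n) ℝ) (hM : M.det ≠ 0) :
    ContinuousAt (fun X : Matrix (Fin n) (Fin n) ℝ => X⁻¹) M := by
  have : (fun X : Matrix (Fin n) (Fin n) ℝ => X⁻¹) = fun X => X.det⁻¹ • X.adjugate := by
    ext1 X; rw [Matrix.inv_def, Ring.inverse_eq_inv']
  rw [this]
  have c1 : Continuous fun X : Matrix (Fin n) (Fin n) ℝ => X.det := continuous_id.matrix_det
  have c2 : Continuous fun X : Matrix (Fin n) (Fin n) ℝ => X.adjugate :=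
    continuous_id.matrix_adjugate
  exact (c1.continuousAt.inv₀ hM).smul c2.continuousAt

lemma U_closure_aux (n : ℕ) (τ : L ≃ₐ[ℚ] L) (hτ : τ alphaL = -alphaL)
    (g : Matrix (Fin n) (Fin n) ℝ) (hg : (1 + g).det ≠ 0) :
    g ∈ closure (incl n '' Uset n τ) := by
  have hu : IsUnit (1 + g).det := hg.isUnit
  set A := (1 - g) * (1 + g)⁻¹ with hA
  have hA1 : 1 + A = (2 : ℝ) • (1 + g)⁻¹ := by
    have : (1 : Matrix (Fin n) (Fin n) ℝ) = (1 + g) * (1 + g)⁻¹ :=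
      (Matrix.mul_nonsing_inv _ hu).symm
    calc 1 + A = (1 + g) * (1 + g)⁻¹ + (1 - g) * (1 + g)⁻¹ := by rw [← this]
      _ = ((1 + g) + (1 - g)) * (1 + g)⁻¹ := (add_mul _ _ _).symm
      _ = ((2 : ℝ) • (1 : Matrix (Fin n) (Fin n) ℝ)) * (1 + g)⁻¹ := by
        congr 1; rw [two_smul]; abel
      _ = _ := by rw [smul_mul_assoc, one_mul]
  have hA2 : 1 - A = g * (1 + A) := by
    have : (1 + A) * (1 + g) = (2 : ℝ) • (1 : Matrix (Fin n) (Fin n) ℝ) := by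
      rw [hA1, smul_mul_assoc, Matrix.nonsing_inv_mul _ hu]
    have h3 : (1 - A) * (1 + g) = g * (1 + A) * (1 + g) := by
      have h4 : A * (1 + g) = 1 - g := by
        rw [hA, Matrix.mul_assoc, Matrix.nonsing_inv_mul _ hu, Matrix.mul_one]
      rw [Matrix.mul_assoc, this, sub_mul, h4, two_smul]
      noncomm_ring
    exact ((Matrix.isUnit_iff_isUnit_det _).2 hu).mul_right_cancel h3
  have hdA : (1 + A).det ≠ 0 := by
    rw [hA1, Matrix.det_smul, Matrix.det_nonsing_inv, Ring.inverse_eq_inv']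
    exact mul_ne_zero (pow_ne_zero _ two_ne_zero) (inv_ne_zero hg)
  let f : Matrix (Fin n) (Fin n) ℝ → Matrix (Fin n) (Fin n) ℝ := fun X => (1 - X) * (1 + X)⁻¹
  have hfA : f A = g := by
    change (1 - A) * (1 + A)⁻¹ = g
    rw [hA2, Matrix.mul_assoc, Matrix.mul_nonsing_inv _ hdA.isUnit, Matrix.mul_one]
  have hfc : ContinuousAt f A := by
    have c0 : ContinuousAt (fun X : Matrix (Fin n) (Fin n) ℝ => 1 + X) A :=
      (continuous_const.add continuous_id).continuousAt
    have c1 : ContinuousAt (fun X : Matrix (Fin n) (Fin n) ℝ => (1 + X)⁻¹) A :=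
      ContinuousAt.comp (f := fun X : Matrix (Fin n) (Fin n) ℝ => 1 + X)
        (g := fun X => X⁻¹) (inv_contAt n _ hdA) c0
    exact (continuous_const.sub continuous_id).continuousAt.mul c1
  have hO : IsOpen {X : Matrix (Fin n) (Fin n) ℝ | (1 + X).det ≠ 0} :=
    isOpen_ne_fun (continuous_const.add continuous_id).matrix_det continuous_const
  have hmem : A ∈ closure ({X : Matrix (Fin n) (Fin n) ℝ | (1 + X).det ≠ 0} ∩
      incl n '' Skew n τ) :=
    (skew_dense n τ hτ).open_subset_closure_inter hO hdA
  rw [← hfA]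
  refine closure_mono ?_ (mem_closure_image hfc hmem)
  rintro _ ⟨_, ⟨hB, B, hBs, rfl⟩, rfl⟩
  have hB' : (1 + B).det ≠ 0 := by
    intro h0
    apply hB
    rw [← map_one (incl n), ← map_add, incl_det, h0, map_zero]
  refine ⟨(1 - B) * (1 + B)⁻¹, cayley_mem n τ B hBs hB', ?_⟩
  have huB : IsUnit (1 + incl n B).det := IsUnit.mk0 _ hB
  apply ((Matrix.isUnit_iff_isUnit_det _).2 huB).mul_right_cancel
  change _ = (1 - incl n B) * (1 + incl n B)⁻¹ * (1 + incl n B)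
  rw [Matrix.mul_assoc (1 - incl n B), Matrix.nonsing_inv_mul _ huB, Matrix.mul_one,
    ← map_one (incl n), ← map_add, ← map_mul, Matrix.mul_assoc,
    Matrix.nonsing_inv_mul _ hB'.isUnit, Matrix.mul_one, map_sub]

lemma U_dense (n : ℕ) (τ : L ≃ₐ[ℚ] L) (hτ : τ alphaL = -alphaL)
    (g : Matrix (Fin n) (Fin n) ℝ) : g ∈ closure (incl n '' Uset n τ) := by
  -- the set of `c` with `det (1 + c g) ≠ 0` is dense
  let p : ℝ[X] := (1 + (X : ℝ[X]) • g.map (C : ℝ → ℝ[X])).det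
  have hp : ∀ c : ℝ, p.eval c = (1 + c • g).det := by
    intro c
    change (Polynomial.evalRingHom c) _ = _
    rw [RingHom.map_det]
    congr 1
    ext i j
    simp [Matrix.one_apply, apply_ite (Polynomial.eval c)]
    ring
  have hp0 : p ≠ 0 := by
    intro h0
    have := hp 0
    rw [h0] at this
    simp at this
  have hfin : Set.Finite {c : ℝ | p.IsRoot c} := Polynomial.finite_setOfPred_isRoot hp0
  have hdense : Dense ({c : ℝ | p.IsRoot c}ᶜ) := Set.Countable.dense_compl ℝ (Set.Finite.countable hfin)
  have h1 : (1 : ℝ) ∈ closure ({c : ℝ | p.IsRoot c}ᶜ) := hdense 1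
  have hc : Continuous fun c : ℝ => c • g := continuous_id.smul continuous_const
  have := mem_closure_image hc.continuousAt h1
  simp only [one_smul] at this
  refine closure_minimal ?_ isClosed_closure this
  rintro _ ⟨c, hc, rfl⟩
  apply U_closure_aux n τ hτ
  rw [← hp]
  exact hc

/-- `G_ℚ = {g ∈ SL_n(L) : τ(gᵀ)·D_n·g = D_n}`, viewed inside `SL_n(ℝ)` via the inclusion
`L ⊂ ℝ`, is dense in `SL_n(ℝ)`. -/
theorem stmt15 (n : ℕ) (hn : 2 ≤ n) (τ : L ≃ₐ[ℚ] L) (hτ : τ alphaL = -alphaL) :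
    Dense {g : Matrix.SpecialLinearGroup (Fin n) ℝ |
      ∃ h : Matrix (Fin n) (Fin n) L, h.det = 1 ∧
        (h.transpose.map τ) * Dmat n * h = Dmat n ∧
        ∀ i j, (h i j : ℝ) = (g : Matrix (Fin n) (Fin n) ℝ) i j} := by
  have hind : Topology.IsInducing
      (fun g : Matrix.SpecialLinearGroup (Fin n) ℝ => (g : Matrix (Fin n) (Fin n) ℝ)) := ⟨rfl⟩
  rw [hind.dense_iff]
  intro g
  let i0 : Fin n := ⟨0, by omega⟩
  let F : Matrix (Fin n) (Fin n) ℝ → Matrix (Fin n) (Fin n) ℝ := fun X =>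
    X * Matrix.diagonal (Function.update (fun _ => 1) i0 X.det⁻¹)
  have hF : ContinuousAt F g := by
    have c1 : Continuous fun X : Matrix (Fin n) (Fin n) ℝ => X.det := continuous_id.matrix_det
    have c2 : ContinuousAt (fun X : Matrix (Fin n) (Fin n) ℝ => X.det⁻¹) g :=
      c1.continuousAt.inv₀ (by simp)
    have c3 : Continuous fun t : ℝ => (Matrix.diagonal
        (Function.update (fun _ : Fin n => (1 : ℝ)) i0 t)) :=
      (continuous_const.update i0 continuous_id).matrix_diagonal
    exact continuousAt_id.mul (c3.continuousAt.comp c2)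
  have hFg : F g = g := by
    simp [F]
  have hm := mem_closure_image hF (U_dense n τ hτ g)
  rw [hFg] at hm
  refine closure_mono ?_ hm
  rintro _ ⟨_, ⟨h, hh, rfl⟩, rfl⟩
  have hU : (h.transpose.map τ) * Dmat n * h = Dmat n := hh
  have hDdet : (Dmat n).det ≠ 0 := by
    change (Matrix.diagonal (dvec n)).det ≠ 0
    rw [Matrix.det_diagonal]
    exact Finset.prod_ne_zero_iff.2 fun i _ => dvec_ne n i
  have hdet : τ h.det * h.det = 1 := by
    have h1 := congrArg Matrix.det hU
    have h2 : (h.transpose.map τ).det = τ h.det := by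
      rw [← Matrix.det_transpose h]
      exact (AlgEquiv.map_det τ h.transpose).symm
    rw [Matrix.det_mul, Matrix.det_mul, h2] at h1
    apply mul_right_cancel₀ hDdet
    rw [one_mul]
    nth_rewrite 2 [← h1]
    ring
  have hd0 : h.det ≠ 0 := right_ne_zero_of_mul_eq_one hdet
  set e : Fin n → L := Function.update (fun _ => 1) i0 h.det⁻¹ with he
  set k := h * Matrix.diagonal e with hk
  have hkdet : k.det = 1 := by
    rw [hk, Matrix.det_mul, Matrix.det_diagonal, he, Finset.prod_update_of_mem (Finset.mem_univ _)]
    simp [hd0]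
  have hkF : incl n k = F (incl n h) := by
    rw [hk, map_mul]
    simp only [F, incl_det]
    congr 1
    ext i j
    by_cases hij : i = j
    · subst hij
      by_cases hi : i = i0
      · subst hi; simp [incl, he]
      · simp [incl, he, hi]
    · simp [incl, hij]
  have hee : ∀ i, τ (e i) * e i = 1 := by
    intro i
    by_cases hi : i = i0
    · subst hi
      simp only [he, Function.update_self, map_inv₀]
      rw [← mul_inv, hdet, inv_one]
    · simp [he, hi]
  have hkU : (k.transpose.map τ) * Dmat n * k = Dmat n := by
    have e1 : k.transpose.map τ = Matrix.diagonal (fun i => τ (e i)) * h.transpose.map τ := by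
      rw [hk, Matrix.transpose_mul, Matrix.map_mul, Matrix.diagonal_transpose,
        Matrix.diagonal_map (map_zero τ)]
    calc (k.transpose.map τ) * Dmat n * k
        = Matrix.diagonal (fun i => τ (e i)) * ((h.transpose.map τ) * Dmat n * h)
          * Matrix.diagonal e := by rw [e1, hk]; simp only [Matrix.mul_assoc]
      _ = Matrix.diagonal (fun i => τ (e i)) * Matrix.diagonal (dvec n)
          * Matrix.diagonal e := by rw [hU]; rfl
      _ = Matrix.diagonal (dvec n) := by
        rw [Matrix.diagonal_mul_diagonal, Matrix.diagonal_mul_diagonal]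
        congr 1
        ext1 i
        rw [mul_right_comm, hee, one_mul]
      _ = Dmat n := rfl
  refine ⟨⟨incl n k, by rw [incl_det, hkdet, map_one]⟩, ⟨k, hkdet, hkU, fun i j => rfl⟩, hkF⟩
end
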